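/- Let C be a normal subgroup of the finitely presented group A such that C is the normal closure in A of a finite subset. Let a₁, …, a_m be elements of A whose images in A/C generate A/C, let F_m be the free group with basis t₁, …, t_m, and let F_m act on the HNN extension A*_C = ⟨A, s | s⁻¹cs = c for all c ∈ C⟩ by letting each tᵢ act on A as conjugation by aᵢ and fix the stable letter s. Then the split extension E' = (A*_C) ⋊ F_m is finitely presented, and E' embeds in the finitely presented group D' = ((A/C * ⟨s⟩) ⋊ F_m) × A, where ⟨s⟩ is the infinite cyclic group generated by s and each tᵢ acts on the free factor A/C as conjugation by the image of aᵢ and fixes s. -/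

import Mathlib

/-- A group is finitely presented if it is isomorphic to the quotient of a finitely generated
free group by the normal closure of a finite set of relators. -/
def IsFinitelyPresentedGroup (G : Type*) [Group G] : Prop :=
  ∃ (n : ℕ) (R : Finset (FreeGroup (Fin n))),
    Nonempty ((FreeGroup (Fin n) ⧸
      Subgroup.normalClosure (R : Set (FreeGroup (Fin n)))) ≃* G)

open Monoid in
theorem fp_iff_aux (G : Type*) [Group G] :
    IsFinitelyPresentedGroup G ↔ Group.IsFinitelyPresented G := by
  constructor
  · rintro ⟨n, R, ⟨e⟩⟩
    have : Group.IsFinitelyPresented (FreeGroup (Fin n) ⧸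
        Subgroup.normalClosure (R : Set (FreeGroup (Fin n)))) :=
      Group.IsFinitelyPresented.quotient _ ⟨R, R.finite_toSet, rfl⟩
    exact Group.IsFinitelyPresented.equiv e
  · intro h
    obtain ⟨n, s, hs, ⟨e⟩⟩ := Group.IsFinitelyPresented.exists_mulEquiv_presentedGroup (G := G)
    obtain ⟨R, rfl⟩ := hs.exists_finset_coe
    exact ⟨n, R, ⟨e.symm⟩⟩

theorem fp_gen_aux (G : Type*) [Group G] [h : Group.IsFinitelyPresented G] :
    ∃ X : Set G, X.Finite ∧ Subgroup.closure X = ⊤ := by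
  obtain ⟨n, φ, hφ, -⟩ := h.out
  refine ⟨φ '' (Set.range FreeGroup.of), (Set.finite_range _).image _, ?_⟩
  rw [← MonoidHom.map_closure, FreeGroup.closure_range_of, ← MonoidHom.range_eq_map,
    MonoidHom.range_eq_top.2 hφ]

theorem fp_of_retract_aux {P G : Type*} [Group P] [Group G] [Group.IsFinitelyPresented P]
    (f : P →* G) (hf : Function.Surjective f) (R : Set P) (hR : R.Finite)
    (hfR : ∀ r ∈ R, f r = 1)
    (g : G →* P ⧸ Subgroup.normalClosure R)
    (hg : g.comp f = QuotientGroup.mk' (Subgroup.normalClosure R)) :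
    Group.IsFinitelyPresented G := by
  refine Group.IsFinitelyPresented.of_surjective f hf ⟨R, hR, le_antisymm ?_ ?_⟩
  · exact Subgroup.normalClosure_le_normal fun r hr => hfR r hr
  · intro x hx
    have h1 := DFunLike.congr_fun hg x
    rw [MonoidHom.comp_apply, MonoidHom.mem_ker.1 hx, map_one] at h1
    exact (QuotientGroup.eq_one_iff x).1 h1.symm

open SemidirectProduct in
theorem fp_semidirect_aux {N G : Type*} [Group N] [Group G] [Group.IsFinitelyPresented N]
    [Group.IsFinitelyPresented G] (φ : G →* MulAut N) :
    Group.IsFinitelyPresented (N ⋊[φ] G) := by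
  obtain ⟨X, hX, hXt⟩ := fp_gen_aux N
  obtain ⟨Y, hY, hYt⟩ := fp_gen_aux G
  let rel : G × N → Monoid.Coprod N G := fun p =>
    Monoid.Coprod.inr p.1 * Monoid.Coprod.inl p.2 * (Monoid.Coprod.inr p.1)⁻¹ *
      (Monoid.Coprod.inl (φ p.1 p.2))⁻¹
  let R : Set (Monoid.Coprod N G) := rel '' (Y ×ˢ X)
  let q := QuotientGroup.mk' (Subgroup.normalClosure R)
  let f : Monoid.Coprod N G →* N ⋊[φ] G := Monoid.Coprod.lift inl inr
  let fn : N →* _ := q.comp Monoid.Coprod.inl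
  let fg : G →* _ := q.comp Monoid.Coprod.inr
  have key0 : ∀ y ∈ Y, ∀ x ∈ X, fn (φ y x) = fg y * fn x * (fg y)⁻¹ := by
    intro y hy x hx
    have : q (rel (y, x)) = 1 :=
      (QuotientGroup.eq_one_iff _).2 (Subgroup.subset_normalClosure ⟨(y, x), ⟨hy, hx⟩, rfl⟩)
    simp only [rel, map_mul, map_inv] at this
    exact (mul_inv_eq_one.1 this).symm
  have key1 : ∀ y ∈ Y, ∀ x, fn (φ y x) = fg y * fn x * (fg y)⁻¹ := by
    intro y hy x
    have : fn.comp (φ y).toMonoidHom = (MulAut.conj (fg y)).toMonoidHom.comp fn := by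
      refine MonoidHom.eq_of_eqOn_dense hXt fun x hx => ?_
      simpa using key0 y hy x hx
    simpa using DFunLike.congr_fun this x
  have key : ∀ y x, fn (φ y x) = fg y * fn x * (fg y)⁻¹ := by
    intro y
    have hy : y ∈ Subgroup.closure Y := hYt ▸ Subgroup.mem_top y
    induction hy using Subgroup.closure_induction with
    | mem y hy => exact key1 y hy
    | one => simp
    | mul a b _ _ ha hb => intro x; simp [ha, hb, mul_assoc]
    | inv a _ ha =>
      intro x
      have := ha (φ a⁻¹ x)
      rw [← MulAut.mul_apply, ← map_mul, mul_inv_cancel, map_one, MulAut.one_apply] at this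
      rw [this]; simp [mul_assoc]
  refine fp_of_retract_aux f ?_ R ((hY.prod hX).image _) ?_
    (SemidirectProduct.lift fn fg ?_) ?_
  · intro x
    refine ⟨Monoid.Coprod.inl x.left * Monoid.Coprod.inr x.right, ?_⟩
    simp [f]
  · rintro _ ⟨⟨y, x⟩, -, rfl⟩
    simp only [rel, f, map_mul, map_inv, Monoid.Coprod.lift_apply_inl,
      Monoid.Coprod.lift_apply_inr, inl_aut]
    simp
  · intro y; ext x; simpa using key y x
  · apply Monoid.Coprod.hom_ext
    · ext x; simp [f, fn, q]
    · ext x; simp [f, fg, q]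

theorem fp_prod_aux {N G : Type*} [Group N] [Group G] [Group.IsFinitelyPresented N]
    [Group.IsFinitelyPresented G] : Group.IsFinitelyPresented (N × G) :=
  have := fp_semidirect_aux (1 : G →* MulAut N)
  Group.IsFinitelyPresented.equiv SemidirectProduct.mulEquivProd

/-- The automorphisms of `A * ⟨s⟩` given by conjugation on `A` and the identity on `s`. -/
def coprodConjAux (A : Type*) [Group A] :
    A →* MulAut (Monoid.Coprod A (Multiplicative ℤ)) where
  toFun x := MulEquiv.coprodCongr (MulAut.conj x) (MulEquiv.refl _)
  map_one' := by
    ext x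
    induction x using Monoid.Coprod.induction_on <;> simp_all
  map_mul' y z := by
    ext x
    induction x using Monoid.Coprod.induction_on <;> simp_all [mul_assoc]

theorem coprodConjAux_inl {A : Type*} [Group A] (x y : A) :
    coprodConjAux A x (Monoid.Coprod.inl y) = Monoid.Coprod.inl (x * y * x⁻¹) := by
  simp [coprodConjAux]

theorem coprodConjAux_inr {A : Type*} [Group A] (x : A) (z : Multiplicative ℤ) :
    coprodConjAux A x (Monoid.Coprod.inr z) = Monoid.Coprod.inr z := by
  simp [coprodConjAux]

section
variable {A : Type*} [Group A] {C : Subgroup A} [C.Normal] {m : ℕ} {a : Fin m → A}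

/-- the map `tᵢ ↦ aᵢ⁻¹` -/
def thetaAux (a : Fin m → A) : FreeGroup (Fin m) →* A := FreeGroup.lift fun i => (a i)⁻¹

theorem freeGroup_act_aux {H B : Type*} [Group H] [Group B] (j : B →* H)
    (ρ : FreeGroup (Fin m) →* MulAut H) (θ : FreeGroup (Fin m) →* B)
    (h : ∀ i x, ρ (FreeGroup.of i) (j x) = j (θ (FreeGroup.of i) * x * (θ (FreeGroup.of i))⁻¹)) :
    ∀ w x, ρ w (j x) = j (θ w * x * (θ w)⁻¹) := by
  intro w
  induction w using FreeGroup.induction_on with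
  | C1 => simp
  | of i => exact h i
  | inv_of i hi =>
    intro x
    rw [map_inv, MulAut.inv_apply, MulEquiv.symm_apply_eq, h i]
    simp [mul_assoc]
  | mul v w hv hw => intro x; rw [map_mul, MulAut.mul_apply, hw x, hv]; simp [mul_assoc]

theorem freeGroup_fix_aux {H : Type*} [Group H] (s : H)
    (ρ : FreeGroup (Fin m) →* MulAut H)
    (h : ∀ i, ρ (FreeGroup.of i) s = s) : ∀ w, ρ w s = s := by
  intro w
  induction w using FreeGroup.induction_on with
  | C1 => simp
  | of i => exact h i
  | inv_of i hi => rw [map_inv, MulAut.inv_apply, MulEquiv.symm_apply_eq, h i]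
  | mul v w hv hw => rw [map_mul, MulAut.mul_apply, hw, hv]

theorem exists_theta_aux
    (ha : Subgroup.closure (Set.range fun i => (QuotientGroup.mk (a i) : A ⧸ C)) = ⊤) (x : A) :
    ∃ w : FreeGroup (Fin m), ∃ c ∈ C, x = thetaAux a w * c := by
  have h : ((QuotientGroup.mk' C).comp (thetaAux a)).range = ⊤ := by
    rw [eq_top_iff, ← ha, Subgroup.closure_le]
    rintro _ ⟨i, rfl⟩
    exact ⟨(FreeGroup.of i)⁻¹, by simp [thetaAux]⟩
  obtain ⟨w, hw⟩ := (h ▸ Subgroup.mem_top (x : A ⧸ C) : (x : A ⧸ C) ∈ _)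
  refine ⟨w, (thetaAux a w)⁻¹ * x, ?_, by simp⟩
  exact QuotientGroup.eq.1 hw

open SemidirectProduct in
theorem fp_hnn_semidirect_aux [Group.IsFinitelyPresented A]
    (hC : ∃ S : Finset A, Subgroup.normalClosure (S : Set A) = C)
    (ha : Subgroup.closure (Set.range fun i => (QuotientGroup.mk (a i) : A ⧸ C)) = ⊤)
    (ρ : FreeGroup (Fin m) →* MulAut (HNNExtension A C C (MulEquiv.refl C)))
    (hρ : ∀ w x, ρ w (HNNExtension.of x) =
      HNNExtension.of (thetaAux a w * x * (thetaAux a w)⁻¹))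
    (hρt : ∀ w, ρ w HNNExtension.t = HNNExtension.t) :
    Group.IsFinitelyPresented
      ((HNNExtension A C C (MulEquiv.refl C)) ⋊[ρ] FreeGroup (Fin m)) := by
  obtain ⟨S, hS⟩ := hC
  obtain ⟨X, hX, hXt⟩ := fp_gen_aux A
  choose wx cx hcx hx using exists_theta_aux (C := C) ha
  let φ := (coprodConjAux A).comp (thetaAux a)
  have hφl : ∀ w x, φ w (Monoid.Coprod.inl x) =
      Monoid.Coprod.inl (thetaAux a w * x * (thetaAux a w)⁻¹) :=
    fun w x => coprodConjAux_inl _ _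
  have hφr : ∀ w z, φ w (Monoid.Coprod.inr z) = Monoid.Coprod.inr z :=
    fun w z => coprodConjAux_inr _ _
  have := fp_semidirect_aux φ
  let iA : A →* ((Monoid.Coprod A (Multiplicative ℤ)) ⋊[φ] FreeGroup (Fin m)) := inl.comp Monoid.Coprod.inl
  let iS : ((Monoid.Coprod A (Multiplicative ℤ)) ⋊[φ] FreeGroup (Fin m)) := inl (Monoid.Coprod.inr (Multiplicative.ofAdd 1))
  let rel : A → ((Monoid.Coprod A (Multiplicative ℤ)) ⋊[φ] FreeGroup (Fin m)) := fun c => iS * iA c * iS⁻¹ * (iA c)⁻¹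
  let T : Set A := (S : Set A) ∪ cx '' X
  have hTC : T ⊆ C := by
    rintro c (h | ⟨x, -, rfl⟩)
    · rw [← hS]; exact Subgroup.subset_normalClosure h
    · exact hcx x
  let R : Set ((Monoid.Coprod A (Multiplicative ℤ)) ⋊[φ] FreeGroup (Fin m)) := rel '' T
  let q := QuotientGroup.mk' (Subgroup.normalClosure R)
  have conjA : ∀ w x, inr w * iA x * (inr w : ((Monoid.Coprod A (Multiplicative ℤ)) ⋊[φ] FreeGroup (Fin m)))⁻¹ =
      iA (thetaAux a w * x * (thetaAux a w)⁻¹) := by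
    intro w x
    simp only [iA, MonoidHom.comp_apply]
    rw [← hφl, inl_aut, map_inv]
  have conjS : ∀ w, inr w * iS * (inr w : ((Monoid.Coprod A (Multiplicative ℤ)) ⋊[φ] FreeGroup (Fin m)))⁻¹ = iS := by
    intro w
    simp only [iS]
    rw [← map_inv, ← inl_aut, hφr]
  -- elements of `A` commuting with `s`
  let K : Subgroup A := (Subgroup.centralizer {q iS}).comap (q.comp iA)
  have memK : ∀ x, x ∈ K ↔ q iS * q (iA x) = q (iA x) * q iS := by
    intro x
    simp only [K, Subgroup.mem_comap, Subgroup.mem_centralizer_singleton_iff,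
      MonoidHom.comp_apply]
    exact eq_comm
  have hTK : T ⊆ K := by
    intro c hc
    have : q (rel c) = 1 :=
      (QuotientGroup.eq_one_iff _).2 (Subgroup.subset_normalClosure ⟨c, hc, rfl⟩)
    simp only [rel, map_mul, map_inv] at this
    refine (memK c).2 ?_
    have h2 := mul_inv_eq_one.1 this
    exact mul_inv_eq_iff_eq_mul.1 h2
  have hKθ : ∀ w, ∀ x ∈ K, thetaAux a w * x * (thetaAux a w)⁻¹ ∈ K := by
    intro w x hxK
    rw [memK] at hxK ⊢
    have : ∀ u v z : ((Monoid.Coprod A (Multiplicative ℤ)) ⋊[φ] FreeGroup (Fin m)) ⧸ Subgroup.normalClosure R, u * v = v * u →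
      (z * u * z⁻¹) * (z * v * z⁻¹) = (z * v * z⁻¹) * (z * u * z⁻¹) := by
      intro u v z h
      calc _ = z * (u * v) * z⁻¹ := by group
        _ = z * (v * u) * z⁻¹ := by rw [h]
        _ = _ := by group
    have h3 := this _ _ (q (inr w)) hxK
    simp only [← map_inv q, ← map_mul q, conjS, conjA] at h3
    simpa only [map_mul q] using h3
  have hnorm : ∀ g : A, g ∈ Subgroup.normalizer (K : Set A) := by
    have hθn : ∀ w, thetaAux a w ∈ Subgroup.normalizer (K : Set A) := by
      intro w
      rw [Subgroup.mem_normalizer_iff]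
      intro x
      refine ⟨hKθ w x, fun h => ?_⟩
      have := hKθ w⁻¹ _ h
      simpa [mul_assoc] using this
    have : Subgroup.closure X ≤ Subgroup.normalizer (K : Set A) := by
      rw [Subgroup.closure_le]
      intro x hxX
      rw [hx x]
      exact mul_mem (hθn _) (Subgroup.le_normalizer (hTK (Or.inr ⟨x, hxX, rfl⟩)))
    intro g
    exact this (hXt ▸ Subgroup.mem_top g)
  have : K.Normal := Subgroup.normalizer_eq_top_iff.1 (eq_top_iff.2 fun g _ => hnorm g)
  have hCK : C ≤ K := by
    rw [← hS]
    exact Subgroup.normalClosure_le_normal fun c hc => hTK (Or.inl hc)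
  let f0 : Monoid.Coprod A (Multiplicative ℤ) →* HNNExtension A C C (MulEquiv.refl C) :=
    Monoid.Coprod.lift HNNExtension.of (zpowersHom _ HNNExtension.t)
  have f0s : f0 (Monoid.Coprod.inr (Multiplicative.ofAdd 1)) = HNNExtension.t := by simp [f0]
  have hf0 : Function.Surjective f0 := by
    intro y
    induction y using HNNExtension.induction_on with
    | of g => exact ⟨Monoid.Coprod.inl g, by simp [f0]⟩
    | t => exact ⟨_, f0s⟩
    | mul x y hx hy =>
      obtain ⟨x, rfl⟩ := hx
      obtain ⟨y, rfl⟩ := hy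
      exact ⟨x * y, map_mul _ _ _⟩
    | inv x hx =>
      obtain ⟨x, rfl⟩ := hx
      exact ⟨x⁻¹, map_inv _ _⟩
  let f : ((Monoid.Coprod A (Multiplicative ℤ)) ⋊[φ] FreeGroup (Fin m)) →* (HNNExtension A C C (MulEquiv.refl C)) ⋊[ρ] FreeGroup (Fin m) :=
    SemidirectProduct.map f0 (MonoidHom.id _) (by
      intro w
      apply Monoid.Coprod.hom_ext
      · ext x
        simp [f0, hφl, hρ]
      · apply MonoidHom.ext_mint
        simp [f0, hφr, hρt])
  have fA : ∀ x, f (iA x) = inl (HNNExtension.of x) := by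
    intro x; simp [f, iA, f0]
  have fS : f iS = inl HNNExtension.t := by
    simp only [f, iS, SemidirectProduct.map_inl, f0s]
  refine fp_of_retract_aux f ?_ R ((S.finite_toSet.union (hX.image _)).image _) ?_
    (SemidirectProduct.lift (HNNExtension.lift (q.comp iA) (q iS) ?_) (q.comp inr) ?_) ?_
  · intro y
    obtain ⟨x, hx⟩ := hf0 y.left
    exact ⟨⟨x, y.right⟩, by ext <;> simp [f, hx]⟩
  · rintro _ ⟨c, hc, rfl⟩
    have hcC := hTC hc
    simp only [rel, map_mul, map_inv, fA, fS]
    have := HNNExtension.t_mul_of (φ := MulEquiv.refl C) ⟨c, hcC⟩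
    simp only [MulEquiv.refl_apply] at this
    rw [← map_mul, this]
    simp
  · rintro ⟨c, hc⟩
    exact (memK c).1 (hCK hc)
  · intro w
    apply HNNExtension.hom_ext
    · ext x
      have := congrArg q (conjA w x)
      simp only [map_mul, map_inv] at this
      simp [hρ, this]
    · have := congrArg q (conjS w)
      simp only [map_mul, map_inv] at this
      simp [hρt, this]
  · apply SemidirectProduct.hom_ext
    · apply Monoid.Coprod.hom_ext
      · ext x
        have h4 := fA x
        simp only [iA, MonoidHom.comp_apply] at h4
        simp only [MonoidHom.comp_apply]
        rw [h4, SemidirectProduct.lift_inl, HNNExtension.lift_of]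
        rfl
      · apply MonoidHom.ext_mint
        simp only [MonoidHom.comp_apply]
        rw [fS, SemidirectProduct.lift_inl, HNNExtension.lift_t]
    · ext w
      simp [f, q]

/-- the projection `A*_C → A/C * ⟨s⟩` -/
def projAux (C : Subgroup A) [C.Normal] : HNNExtension A C C (MulEquiv.refl C) →*
    Monoid.Coprod (A ⧸ C) (Multiplicative ℤ) :=
  HNNExtension.lift (Monoid.Coprod.inl.comp (QuotientGroup.mk' C))
    (Monoid.Coprod.inr (Multiplicative.ofAdd 1)) (by
      rintro ⟨c, hc⟩
      have : (c : A ⧸ C) = 1 := (QuotientGroup.eq_one_iff c).2 hc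
      simp [this])

/-- the retraction `A*_C → A` killing `s` -/
def retrAux (C : Subgroup A) : HNNExtension A C C (MulEquiv.refl C) →* A :=
  HNNExtension.lift (MonoidHom.id A) 1 (by simp)

theorem ker_projAux (h : HNNExtension A C C (MulEquiv.refl C)) (hh : projAux C h = 1) :
    ∃ c : A, h = HNNExtension.of c := by
  let M : Subgroup (HNNExtension A C C (MulEquiv.refl C)) := C.map HNNExtension.of
  have hM : M.Normal := by
    rw [← Subgroup.normalizer_eq_top_iff, eq_top_iff]
    intro g _
    induction g using HNNExtension.induction_on with
    | of g =>
      rw [Subgroup.mem_normalizer_iff]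
      have hmem : ∀ g : A, ∀ x ∈ M, HNNExtension.of g * x * (HNNExtension.of g)⁻¹ ∈ M := by
        rintro g _ ⟨c, hc, rfl⟩
        exact ⟨g * c * g⁻¹, Subgroup.Normal.conj_mem ‹_› c hc g, by simp⟩
      intro x
      refine ⟨hmem g x, fun h => ?_⟩
      have := hmem g⁻¹ _ h
      simpa [mul_assoc] using this
    | t =>
      have hc : ∀ c ∈ C, (HNNExtension.t : HNNExtension A C C (MulEquiv.refl C)) *
          HNNExtension.of c = HNNExtension.of c * HNNExtension.t := fun c hc =>
        HNNExtension.t_mul_of (φ := MulEquiv.refl C) ⟨c, hc⟩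
      rw [Subgroup.mem_normalizer_iff]
      intro x
      constructor
      · rintro ⟨c, hcC, rfl⟩
        exact ⟨c, hcC, by rw [hc c hcC]; simp⟩
      · rintro ⟨c, hcC, h⟩
        refine ⟨c, hcC, ?_⟩
        rw [eq_mul_inv_iff_mul_eq, ← hc c hcC] at h
        exact mul_left_cancel h
    | mul x y hx hy => exact mul_mem (hx trivial) (hy trivial)
    | inv x hx => exact inv_mem (hx trivial)
  let q := QuotientGroup.mk' M
  let r : Monoid.Coprod (A ⧸ C) (Multiplicative ℤ) →* _ ⧸ M :=
    Monoid.Coprod.lift (QuotientGroup.lift C (q.comp HNNExtension.of) (by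
      intro c hc
      exact (QuotientGroup.eq_one_iff _).2 ⟨c, hc, rfl⟩)) (zpowersHom _ (q HNNExtension.t))
  have hr : r.comp (projAux C) = q := by
    apply HNNExtension.hom_ext
    · ext x; simp [r, projAux]; rfl
    · simp [r, projAux]
  have h1 := DFunLike.congr_fun hr h
  rw [MonoidHom.comp_apply, hh, map_one] at h1
  obtain ⟨c, -, hc⟩ := (QuotientGroup.eq_one_iff h).1 h1.symm
  exact ⟨c, hc.symm⟩
end

/-- Theorem 8: Let `C` be a normal subgroup of the finitely presented group `A`
which is the normal closure of a finite subset of `A`. Let `a₁, …, a_m ∈ A` have images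
generating `A/C`, let `F_m` be the free group on `t₁, …, t_m`, and let `F_m` act on the HNN
extension `A*_C = ⟨A, s | s⁻¹cs = c, ∀ c ∈ C⟩` with `tᵢ` acting on `A` as conjugation by `aᵢ`
and fixing the stable letter `s`. Then `E' = (A*_C) ⋊ F_m` is finitely presented, and `E'`
embeds in the finitely presented group `D' = ((A/C * ⟨s⟩) ⋊ F_m) × A`, where `⟨s⟩` is infinite
cyclic and `tᵢ` acts on the free factor `A/C` as conjugation by the image of `aᵢ`, fixing `s`. -/
theorem split_extension_of_hnn_finitely_presented_and_embeds
    (A : Type*) [Group A] (C : Subgroup A) [C.Normal]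
    (hA : IsFinitelyPresentedGroup A)
    (hC : ∃ S : Finset A, Subgroup.normalClosure (S : Set A) = C)
    (m : ℕ) (a : Fin m → A)
    (ha : Subgroup.closure (Set.range fun i => (QuotientGroup.mk (a i) : A ⧸ C)) = ⊤)
    -- the action of `F_m` on `A*_C`: `tᵢ` acts on `A` by conjugation by `aᵢ` and fixes `s`
    (ρ : FreeGroup (Fin m) →* MulAut (HNNExtension A C C (MulEquiv.refl C)))
    (hρ : ∀ (i : Fin m) (x : A),
      ρ (FreeGroup.of i) (HNNExtension.of x) = HNNExtension.of ((a i)⁻¹ * x * a i))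
    (hρt : ∀ (i : Fin m),
      ρ (FreeGroup.of i) (HNNExtension.t : HNNExtension A C C (MulEquiv.refl C)) =
        HNNExtension.t)
    -- the action of `F_m` on `A/C * ⟨s⟩`: `tᵢ` acts on the factor `A/C` by conjugation by
    -- the image of `aᵢ` and fixes the factor `⟨s⟩`
    (σ : FreeGroup (Fin m) →* MulAut (Monoid.Coprod (A ⧸ C) (Multiplicative ℤ)))
    (hσl : ∀ (i : Fin m) (q : A ⧸ C), σ (FreeGroup.of i) (Monoid.Coprod.inl q) =
      Monoid.Coprod.inl ((QuotientGroup.mk (a i) : A ⧸ C)⁻¹ * q * QuotientGroup.mk (a i)))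
    (hσr : ∀ (i : Fin m) (z : Multiplicative ℤ),
      σ (FreeGroup.of i) (Monoid.Coprod.inr z) = Monoid.Coprod.inr z) :
    IsFinitelyPresentedGroup
      ((HNNExtension A C C (MulEquiv.refl C)) ⋊[ρ] FreeGroup (Fin m)) ∧
    IsFinitelyPresentedGroup
      (((Monoid.Coprod (A ⧸ C) (Multiplicative ℤ)) ⋊[σ] FreeGroup (Fin m)) × A) ∧
    ∃ f : ((HNNExtension A C C (MulEquiv.refl C)) ⋊[ρ] FreeGroup (Fin m)) →*
        ((Monoid.Coprod (A ⧸ C) (Multiplicative ℤ)) ⋊[σ] FreeGroup (Fin m)) × A,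
      Function.Injective f := by
  have : Group.IsFinitelyPresented A := (fp_iff_aux A).1 hA
  have hρ' := freeGroup_act_aux HNNExtension.of ρ (thetaAux a) (by
    intro i x; simp [hρ, thetaAux])
  have hρt' := freeGroup_fix_aux HNNExtension.t ρ hρt
  have hσl' := freeGroup_act_aux Monoid.Coprod.inl σ ((QuotientGroup.mk' C).comp (thetaAux a)) (by
    intro i x; simp [hσl, thetaAux])
  have hσr' : ∀ w z, σ w (Monoid.Coprod.inr z) = Monoid.Coprod.inr z := fun w z =>
    freeGroup_fix_aux _ σ (fun i => hσr i z) w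
  refine ⟨(fp_iff_aux _).2 (fp_hnn_semidirect_aux hC ha ρ hρ' hρt'), (fp_iff_aux _).2 ?_, ?_⟩
  · have : Group.IsFinitelyPresented (A ⧸ C) := by
      obtain ⟨S, hS⟩ := hC
      exact Group.IsFinitelyPresented.quotient _ ⟨S, S.finite_toSet, hS⟩
    have := fp_semidirect_aux σ
    exact fp_prod_aux
  · let f1 : ((HNNExtension A C C (MulEquiv.refl C)) ⋊[ρ] FreeGroup (Fin m)) →*
        ((Monoid.Coprod (A ⧸ C) (Multiplicative ℤ)) ⋊[σ] FreeGroup (Fin m)) :=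
      SemidirectProduct.map (projAux C) (MonoidHom.id _) (by
        intro w
        apply HNNExtension.hom_ext
        · ext x
          simp [projAux, hρ', hσl']
        · simp [projAux, hρt', hσr'])
    let f2 : ((HNNExtension A C C (MulEquiv.refl C)) ⋊[ρ] FreeGroup (Fin m)) →* A :=
      SemidirectProduct.lift (retrAux C) (thetaAux a) (by
        intro w
        apply HNNExtension.hom_ext
        · ext x
          simp [retrAux, hρ']
        · simp [retrAux, hρt'])
    refine ⟨f1.prod f2, (injective_iff_map_eq_one _).2 ?_⟩
    rintro ⟨h, w⟩ hx
    have h1 : f1 ⟨h, w⟩ = 1 := congrArg Prod.fst hx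
    have h2 : f2 ⟨h, w⟩ = 1 := congrArg Prod.snd hx
    have hw : w = 1 := congrArg SemidirectProduct.right h1
    have hl : projAux C h = 1 := congrArg SemidirectProduct.left h1
    subst hw
    obtain ⟨c, rfl⟩ := ker_projAux h hl
    have hc : c = 1 := by
      rw [SemidirectProduct.mk_eq_inl_mul_inr] at h2
      simpa [f2, retrAux] using h2
    subst hc
    ext <;> simp
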